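/- arXiv:2104.05898 — 2 statements merged into one kernel-verified Lean document; each statement's English description precedes it below -/
import Mathlib

section
/- Let d ≥ 1, a > 0, C₁ > 1, and let ω : [1,2]^d → R^d be a real analytic map with det(∂_I ω(I)) ≥ c₃ > 0 on [1,2]^d (so ω is a diffeomorphism onto its image) and |ω(I)| ≤ C on [1,2]^d. For 0 < ε ≪ 1 set γ = (log(1/ε))^{-2C₁} and let Θ be the set of I₀ ∈ [1,2]^d such that |ε^{-a}⟨k,ω(I₀)⟩ + l| ≥ ε^{-a}γ/|k|^{d+1} for all k ∈ Z^d∖{0}, l ∈ Z with |k|+|l| ≤ (log(1/ε))^{C₁}, and |ε^{-a}⟨k,ω(I₀)⟩ + l| ≥ γ/(1+|k|)^{d+1} for all (k,l) ∈ Z^d × Z with |k|+|l| > (log(1/ε))^{C₁}. Then there is a constant C (depending on d, C₁, a and ω) such that Leb([1,2]^d ∖ Θ) ≤ C (log(1/ε))^{-C₁}; in particular Leb(Θ) → 1 as ε → 0. -/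
open MeasureTheory Set

/-- The power `-(d + 1)` of the `ℓ¹` norm is summable over `ℤ^d`. -/
lemma summable_one_div_sum_abs_pow (d : ℕ) :
    Summable fun k : Fin d → ℤ ↦ 1 / (∑ i, |(k i : ℝ)|) ^ (d + 1) := by
  let b := Pi.basisFun ℝ (Fin d)
  let L : Submodule ℤ (Fin d → ℝ) := Submodule.span ℤ (range b)
  have hrank : Module.finrank ℤ L = d := by
    simpa using Module.finrank_eq_card_basis (b.restrictScalars ℤ)
  have hmem (k : Fin d → ℤ) : (fun i ↦ (k i : ℝ)) ∈ L := by
    rw [b.mem_span_iff_repr_mem ℤ]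
    intro i
    simp [b]
  let φ : (Fin d → ℤ) → L := fun k ↦ ⟨fun i ↦ (k i : ℝ), hmem k⟩
  have hφ : Function.Injective φ := by
    intro k k' h
    funext i
    exact Int.cast_injective (α := ℝ) (congrFun (congrArg Subtype.val h) i)
  have hsum := (ZLattice.summable_norm_zpow L (-(d + 1 : ℤ))
    (by rw [hrank]; omega)).comp_injective hφ
  refine hsum.of_nonneg_of_le (fun k ↦ by positivity) fun k ↦ ?_
  have hle : ‖φ k‖ ≤ ∑ i, |(k i : ℝ)| := by
    change ‖(fun i ↦ (k i : ℝ))‖ ≤ _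
    refine (pi_norm_le_iff_of_nonneg (by positivity)).2 fun i ↦ ?_
    exact Finset.single_le_sum (f := fun i ↦ |(k i : ℝ)|) (fun j _ ↦ abs_nonneg _)
      (Finset.mem_univ i)
  rcases eq_or_ne k 0 with rfl | hk
  · simp only [Pi.zero_apply, Int.cast_zero, abs_zero, Finset.sum_const_zero]
    rw [zero_pow (by omega)]
    simp only [div_zero, Function.comp_apply]
    positivity
  have hpos : 0 < ‖φ k‖ := by
    refine norm_pos_iff.2 fun h ↦ hk (hφ (h.trans ?_))
    ext i
    simp [φ]
  have hz : (‖φ k‖) ^ (-(d + 1 : ℤ)) = 1 / ‖φ k‖ ^ (d + 1) := by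
    rw [zpow_neg, one_div]
    norm_cast
  simp only [Function.comp_apply, hz]
  gcongr

/-- Volume of the intersection of a slab of width `δ` orthogonal to an integer vector with a
cube. -/
lemma volume_slab_inter_cube_le {d : ℕ} {k : Fin d → ℤ} (hk : k ≠ 0) (s : ℝ) {δ R : ℝ}
    (hδ : 0 ≤ δ) (hR : 0 ≤ R) :
    volume {y : Fin d → ℝ | (∀ i, |y i| ≤ R) ∧ |(∑ i, (k i : ℝ) * y i) + s| < δ}
      ≤ ENNReal.ofReal (2 * d * (2 * R) ^ (d - 1) * (δ / ∑ i, |(k i : ℝ)|)) := by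
  obtain ⟨j, hj⟩ := Function.ne_iff.1 hk
  have : Nonempty (Fin d) := ⟨j⟩
  obtain ⟨i, hi⟩ := Finite.exists_max fun i ↦ |(k i : ℝ)|
  have hki : 0 < |(k i : ℝ)| := (abs_pos.2 (by exact_mod_cast hj)).trans_le (hi j)
  have hsum_pos : 0 < ∑ i, |(k i : ℝ)| :=
    hki.trans_le (Finset.single_le_sum (f := fun i ↦ |(k i : ℝ)|) (fun j _ ↦ abs_nonneg _)
      (Finset.mem_univ i))
  have hsum : ∑ i, |(k i : ℝ)| ≤ d * |(k i : ℝ)| := by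
    simpa using Finset.sum_le_card_nsmul Finset.univ _ _ fun l _ ↦ hi l
  let M : Matrix (Fin d) (Fin d) ℝ := (1 : Matrix (Fin d) (Fin d) ℝ).updateRow i fun l ↦ (k l : ℝ)
  have hdet : LinearMap.det (Matrix.toLin' M) = k i := by
    rw [LinearMap.det_toLin', ← Matrix.cramer_transpose_apply, Matrix.transpose_one,
      Matrix.cramer_one, Module.End.one_apply]
  let lo : Fin d → ℝ := Function.update (fun _ ↦ -R) i (-δ - s)
  let hi' : Fin d → ℝ := Function.update (fun _ ↦ R) i (δ - s)
  have hsub : {y : Fin d → ℝ | (∀ i, |y i| ≤ R) ∧ |(∑ i, (k i : ℝ) * y i) + s| < δ}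
      ⊆ Matrix.toLin' M ⁻¹' Icc lo hi' := by
    rintro y ⟨hy, hys⟩
    have hval (l : Fin d) : Matrix.toLin' M y l = if l = i then ∑ i, (k i : ℝ) * y i else y l := by
      rw [Matrix.toLin'_apply, Matrix.mulVec]
      split_ifs with h
      · subst h
        simp [M, dotProduct]
      · simp [M, Matrix.updateRow_ne h, dotProduct, Matrix.one_apply]
    rw [abs_lt] at hys
    refine ⟨fun l ↦ ?_, fun l ↦ ?_⟩ <;> rw [hval] <;> rcases eq_or_ne l i with rfl | h
    · simp only [lo, Function.update_self, if_true]; linarith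
    · simpa [lo, h] using (abs_le.1 (hy l)).1
    · simp only [hi', Function.update_self, if_true]; linarith
    · simpa [hi', h] using (abs_le.1 (hy l)).2
  have hvol : volume (Icc lo hi') = ENNReal.ofReal (2 * δ * (2 * R) ^ (d - 1)) := by
    have (l : Fin d) : ENNReal.ofReal (hi' l - lo l) =
        Function.update (fun _ ↦ ENNReal.ofReal (2 * R)) i (ENNReal.ofReal (2 * δ)) l := by
      rcases eq_or_ne l i with rfl | h
      · simp only [hi', lo, Function.update_self]; congr 1; ring
      · simp only [hi', lo, Function.update_of_ne h]; congr 1; ring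
    rw [Real.volume_Icc_pi, Finset.prod_congr rfl fun l _ ↦ this l,
      Finset.prod_update_of_mem (Finset.mem_univ i), Finset.prod_const,
      Finset.card_sdiff_of_subset (by simp), ENNReal.ofReal_mul (p := 2 * δ) (by positivity),
      ENNReal.ofReal_pow (by positivity)]
    simp
  calc _ ≤ volume (Matrix.toLin' M ⁻¹' Icc lo hi') := measure_mono hsub
    _ = ENNReal.ofReal (|(k i : ℝ)|⁻¹ * (2 * δ * (2 * R) ^ (d - 1))) := by
      rw [Measure.addHaar_preimage_linearMap _ (by rw [hdet]; exact abs_pos.1 hki), hdet, hvol,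
        abs_inv, ← ENNReal.ofReal_mul (by positivity)]
    _ ≤ _ := by
      refine ENNReal.ofReal_le_ofReal ?_
      have : |(k i : ℝ)|⁻¹ ≤ d / ∑ i, |(k i : ℝ)| := by
        rw [inv_le_comm₀ hki (div_pos (by exact_mod_cast i.pos) hsum_pos), inv_div]
        exact (div_le_iff₀' (by exact_mod_cast i.pos)).2 hsum
      calc _ ≤ d / (∑ i, |(k i : ℝ)|) * (2 * δ * (2 * R) ^ (d - 1)) := by gcongr
        _ = _ := by ring

/-- On a compact set where a map is strictly differentiable with invertible derivative, the volume
of subsets is controlled by the volume of their images. -/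
lemma IsCompact.exists_volume_le_mul_volume_image {E : Type*} [NormedAddCommGroup E]
    [NormedSpace ℝ E] [FiniteDimensional ℝ E] [MeasurableSpace E] [BorelSpace E]
    (μ : Measure E) [μ.IsAddHaarMeasure] {K : Set E} (hK : IsCompact K) {f : E → E}
    {f' : E → E →L[ℝ] E} (hf : ∀ x ∈ K, HasStrictFDerivAt f (f' x) x)
    (hdet : ∀ x ∈ K, (f' x).det ≠ 0) :
    ∃ C : NNReal, ∀ t ⊆ K, μ t ≤ C * μ (f '' t) := by
  refine hK.induction_on (p := fun s ↦ ∃ C : NNReal, ∀ t ⊆ s, μ t ≤ C * μ (f '' t))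
    ⟨0, fun t ht ↦ by simp [subset_empty_iff.1 ht]⟩
    (fun s s' hs ⟨C, hC⟩ ↦ ⟨C, fun t ht ↦ hC t (ht.trans hs)⟩) ?_ ?_
  · rintro s s' ⟨C, hC⟩ ⟨C', hC'⟩
    refine ⟨C + C', fun t ht ↦ ?_⟩
    calc μ t ≤ μ (t ∩ s) + μ (t ∩ s') := by
          refine le_trans (measure_mono ?_) (measure_union_le _ _)
          rw [← inter_union_distrib_left]
          exact subset_inter subset_rfl ht
      _ ≤ C * μ (f '' (t ∩ s)) + C' * μ (f '' (t ∩ s')) :=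
        add_le_add (hC _ inter_subset_right) (hC' _ inter_subset_right)
      _ ≤ C * μ (f '' t) + C' * μ (f '' t) := by gcongr <;> exact inter_subset_left
      _ = _ := by push_cast; ring
  · intro x hx
    obtain ⟨m, hm0, hm⟩ := ENNReal.lt_iff_exists_nnreal_btwn.1
      (ENNReal.ofReal_pos.2 (abs_pos.2 (hdet x hx)))
    have hm0 : m ≠ 0 := by exact_mod_cast hm0.ne'
    obtain ⟨δ, hδ, hδpos⟩ :=
      ((mul_le_addHaar_image_of_lt_det μ (f' x) hm).and self_mem_nhdsWithin).exists
    obtain ⟨U, hU, hfU⟩ := (hf x hx).approximates_deriv_on_nhds (Or.inr hδpos)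
    refine ⟨U, mem_nhdsWithin_of_mem_nhds hU, m⁻¹, fun t ht ↦ ?_⟩
    rw [ENNReal.coe_inv hm0, mul_comm, ← div_eq_mul_inv,
      ENNReal.le_div_iff_mul_le (by simp [hm0]) (by simp), mul_comm]
    exact hδ t f (hfU.mono_set ht)

/-- Union bound over the integers in a symmetric interval. -/
lemma measure_iUnion_abs_int_le {α : Type*} [MeasurableSpace α] (μ : Measure α) (s : ℤ → Set α)
    {B v : ℝ} (hB : 0 ≤ B) (hs : ∀ l, μ (s l) ≤ ENNReal.ofReal v) :
    μ (⋃ l : ℤ, ⋃ _ : |(l : ℝ)| ≤ B, s l) ≤ ENNReal.ofReal ((2 * B + 1) * v) := by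
  have hsub : (⋃ l : ℤ, ⋃ _ : |(l : ℝ)| ≤ B, s l) ⊆ ⋃ l ∈ Finset.Icc (-⌊B⌋) ⌊B⌋, s l := by
    refine iUnion_mono fun l ↦ iUnion_mono' fun hl ↦ ⟨?_, subset_rfl⟩
    have := abs_le.1 (Int.le_floor.2 (by exact_mod_cast hl : ((|l| : ℤ) : ℝ) ≤ B))
    exact Finset.mem_Icc.2 this
  have hcard : ((Finset.Icc (-⌊B⌋) ⌊B⌋).card : ℝ) ≤ 2 * B + 1 := by
    have h0 : 0 ≤ ⌊B⌋ := Int.floor_nonneg.2 hB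
    have : ((Finset.Icc (-⌊B⌋) ⌊B⌋).card : ℤ) = 2 * ⌊B⌋ + 1 := by
      rw [Int.card_Icc]; omega
    have h : ((Finset.Icc (-⌊B⌋) ⌊B⌋).card : ℝ) = 2 * ⌊B⌋ + 1 := by exact_mod_cast this
    linarith [Int.floor_le B]
  calc _ ≤ ∑ l ∈ Finset.Icc (-⌊B⌋) ⌊B⌋, μ (s l) :=
        (measure_mono hsub).trans (measure_biUnion_finset_le _ _)
    _ ≤ (Finset.Icc (-⌊B⌋) ⌊B⌋).card * ENNReal.ofReal v := by
        rw [← nsmul_eq_mul]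
        exact Finset.sum_le_card_nsmul _ _ _ fun l _ ↦ hs l
    _ ≤ ENNReal.ofReal (2 * B + 1) * ENNReal.ofReal v := by
        gcongr
        rw [← ENNReal.ofReal_natCast]
        exact ENNReal.ofReal_le_ofReal hcard
    _ = _ := (ENNReal.ofReal_mul (by positivity)).symm

/-- Arithmetic of the union bound over the resonances of a single integer vector of length `m`. -/
lemma resonance_count_bound {D N γ A m Cb : ℝ} (d : ℕ) (hD : 0 ≤ D) (hN : 1 ≤ N) (hγ : 0 ≤ γ)
    (hA : 1 ≤ A) (hm : 1 ≤ m) (hCb : 0 ≤ Cb) :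
    (2 * N + 1) * (D * (γ / m ^ (d + 1) / m))
        + (2 * (A * m * Cb + 1) + 1) * (D * (γ / (A * m ^ (d + 1)) / m))
      ≤ D * (2 * Cb + 6) * (N * γ) * (1 / m ^ (d + 1)) := by
  have hm0 : 0 < m := by linarith
  have hA0 : 0 < A := by linarith
  have h1 : (2 * N + 1) / m ≤ 3 * N := by
    rw [div_le_iff₀ hm0]; nlinarith
  have h2 : (2 * (A * m * Cb + 1) + 1) / (A * m) ≤ (2 * Cb + 3) * N := by
    have hAm : 1 ≤ A * m := one_le_mul_of_one_le_of_one_le hA hm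
    rw [div_le_iff₀ (by positivity)]
    have : (2 * Cb + 3) * (A * m) ≤ (2 * Cb + 3) * (A * m) * N :=
      le_mul_of_one_le_right (by positivity) hN
    nlinarith
  calc _ = D * γ * (1 / m ^ (d + 1)) *
        ((2 * N + 1) / m + (2 * (A * m * Cb + 1) + 1) / (A * m)) := by
        field_simp
    _ ≤ D * γ * (1 / m ^ (d + 1)) * (3 * N + (2 * Cb + 3) * N) := by gcongr
    _ = _ := by ring


/-- Measure estimate for the Diophantine set: if `ω : [1,2]^d → ℝ^d` is real
analytic, Kolmogorov non-degenerate (`det ∂ω ≥ c₃ > 0`) and bounded, and `Θ(ε)` is the set of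
`I₀ ∈ [1,2]^d` whose frequency `ω(I₀)` satisfies the two-scale Diophantine conditions with
`γ = (log(1/ε))^(-2C₁)` and cutoff `(log(1/ε))^(C₁)` (with `|k|` the ℓ¹ norm), then
`Leb([1,2]^d ∖ Θ(ε)) ≤ C (log(1/ε))^(-C₁)` for all sufficiently small `ε > 0`;
in particular `Leb Θ(ε) → 1` as `ε → 0`. -/
theorem stmt3 (d : ℕ) (hd : 1 ≤ d) (a C₁ c₃ Cb : ℝ)
    (ha : 0 < a) (hC₁ : 1 < C₁) (hc₃ : 0 < c₃) (hCb : 0 < Cb)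
    (ω : (Fin d → ℝ) → (Fin d → ℝ))
    (box : Set (Fin d → ℝ)) (hbox : box = {I : Fin d → ℝ | ∀ i, I i ∈ Icc (1 : ℝ) 2})
    (hωanal : AnalyticOnNhd ℝ ω box)
    (hjac : ∀ I ∈ box, c₃ ≤ (Matrix.of fun i j : Fin d => fderiv ℝ ω I (Pi.single j 1) i).det)
    (hωbd : ∀ I ∈ box, ‖ω I‖ ≤ Cb) :
    ∃ C : ℝ, 0 < C ∧ ∃ εstar : ℝ, 0 < εstar ∧ εstar < 1 ∧
      ∀ ε : ℝ, 0 < ε → ε < εstar →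
      volume (box \
        {I₀ : Fin d → ℝ | I₀ ∈ box ∧
          (∀ k : Fin d → ℤ, k ≠ 0 → ∀ l : ℤ,
            (∑ i, |(k i : ℝ)|) + |(l : ℝ)| ≤ Real.log (1 / ε) ^ C₁ →
            ε ^ (-a) * Real.log (1 / ε) ^ (-(2 * C₁)) / (∑ i, |(k i : ℝ)|) ^ (d + 1)
              ≤ |ε ^ (-a) * (∑ i, (k i : ℝ) * ω I₀ i) + (l : ℝ)|) ∧
          (∀ k : Fin d → ℤ, ∀ l : ℤ, ¬(k = 0 ∧ l = 0) →
            Real.log (1 / ε) ^ C₁ < (∑ i, |(k i : ℝ)|) + |(l : ℝ)| →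
            Real.log (1 / ε) ^ (-(2 * C₁)) / (1 + ∑ i, |(k i : ℝ)|) ^ (d + 1)
              ≤ |ε ^ (-a) * (∑ i, (k i : ℝ) * ω I₀ i) + (l : ℝ)|)})
        ≤ ENNReal.ofReal (C * Real.log (1 / ε) ^ (-C₁)) := by
  have hboxc : IsCompact box := by
    have : box = Icc (fun _ ↦ 1) (fun _ ↦ 2) := by
      rw [hbox]; ext I; simp [Pi.le_def, forall_and]
    exact this ▸ isCompact_Icc
  obtain ⟨Ccov, hCcov⟩ := hboxc.exists_volume_le_mul_volume_image volume
    (fun I hI ↦ (hωanal I hI).hasStrictFDerivAt) fun I hI ↦ by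
      have hmat : (Matrix.of fun i j : Fin d ↦ fderiv ℝ ω I (Pi.single j 1) i)
          = LinearMap.toMatrix' (fderiv ℝ ω I : (Fin d → ℝ) →ₗ[ℝ] (Fin d → ℝ)) := by
        ext i j
        simp [LinearMap.toMatrix'_apply]
      have := hjac I hI
      rw [hmat, LinearMap.det_toMatrix'] at this
      exact (hc₃.trans_le this).ne'
  let D : ℝ := Ccov * (2 * d * (2 * Cb) ^ (d - 1))
  have hD : 0 ≤ D := by positivity
  have hslab (k : Fin d → ℤ) (hk : k ≠ 0) (s δ : ℝ) (hδ : 0 ≤ δ) :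
      volume {I | I ∈ box ∧ |(∑ i, (k i : ℝ) * ω I i) + s| < δ}
        ≤ ENNReal.ofReal (D * (δ / ∑ i, |(k i : ℝ)|)) := by
    refine (hCcov _ fun I hI ↦ hI.1).trans ?_
    calc _ ≤ (Ccov : ENNReal) * volume {y : Fin d → ℝ |
            (∀ i, |y i| ≤ Cb) ∧ |(∑ i, (k i : ℝ) * y i) + s| < δ} := by
          gcongr
          rintro _ ⟨I, ⟨hI, hIs⟩, rfl⟩
          exact ⟨fun i ↦ (norm_le_pi_norm (ω I) i).trans (hωbd I hI), hIs⟩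
      _ ≤ Ccov * ENNReal.ofReal (2 * d * (2 * Cb) ^ (d - 1) * (δ / ∑ i, |(k i : ℝ)|)) := by
          gcongr
          exact volume_slab_inter_cube_le hk s hδ hCb.le
      _ = _ := by
          rw [← ENNReal.ofReal_coe_nnreal, ← ENNReal.ofReal_mul (by positivity), ← mul_assoc]
  have hsummable := summable_one_div_sum_abs_pow d
  let W : ℝ := ∑' k : Fin d → ℤ, 1 / (∑ i, |(k i : ℝ)|) ^ (d + 1)
  have hW : 0 ≤ W := tsum_nonneg fun k ↦ by positivity
  refine ⟨D * (2 * Cb + 6) * W + 1, by positivity, Real.exp (-1), Real.exp_pos _, by simp,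
    fun ε hε hε1 ↦ ?_⟩
  have hL : 1 < Real.log (1 / ε) := by
    rw [one_div, Real.log_inv]
    have := Real.log_lt_log hε hε1
    rw [Real.log_exp] at this
    linarith
  set L := Real.log (1 / ε)
  have hL0 : 0 < L := by linarith
  set N := L ^ C₁
  set γ := L ^ (-(2 * C₁))
  set A := ε ^ (-a)
  have hN : 1 ≤ N := Real.one_le_rpow hL.le (by linarith)
  have hγ0 : 0 < γ := Real.rpow_pos_of_pos hL0 _
  have hγ1 : γ ≤ 1 := Real.rpow_le_one_of_one_le_of_nonpos hL.le (by linarith)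
  have hNγ : N * γ = L ^ (-C₁) := by
    rw [← Real.rpow_add hL0]; ring_nf
  have hA : 1 ≤ A := Real.one_le_rpow_of_pos_of_le_one_of_nonpos hε
    (hε1.le.trans (by simp)) (by linarith)
  have hA0 : 0 < A := by linarith
  let bad (k : Fin d → ℤ) : Set (Fin d → ℝ) :=
    (⋃ l : ℤ, ⋃ _ : |(l : ℝ)| ≤ N, {I | I ∈ box ∧
      |(∑ i, (k i : ℝ) * ω I i) + l / A| < γ / (∑ i, |(k i : ℝ)|) ^ (d + 1)}) ∪
    ⋃ l : ℤ, ⋃ _ : |(l : ℝ)| ≤ A * (∑ i, |(k i : ℝ)|) * Cb + 1, {I | I ∈ box ∧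
      |(∑ i, (k i : ℝ) * ω I i) + l / A| < γ / (A * (∑ i, |(k i : ℝ)|) ^ (d + 1))}
  have hone (k : Fin d → ℤ) (hk : k ≠ 0) : 1 ≤ ∑ i, |(k i : ℝ)| := by
    obtain ⟨j, hj⟩ := Function.ne_iff.1 hk
    have h1 : (1 : ℝ) ≤ |(k j : ℝ)| := by exact_mod_cast Int.one_le_abs hj
    exact h1.trans (Finset.single_le_sum (f := fun i ↦ |(k i : ℝ)|) (fun j _ ↦ abs_nonneg _)
      (Finset.mem_univ j))
  have hbad (k : Fin d → ℤ) : volume (⋃ _ : k ≠ 0, bad k) ≤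
      ENNReal.ofReal (D * (2 * Cb + 6) * (N * γ) * (1 / (∑ i, |(k i : ℝ)|) ^ (d + 1))) := by
    by_cases hk : k = 0
    · simp [hk]
    simp only [ne_eq, hk, not_false_eq_true, iUnion_true]
    refine (measure_union_le _ _).trans ?_
    refine (add_le_add
      (measure_iUnion_abs_int_le volume _ (by positivity)
        fun l ↦ hslab k hk _ _ (by positivity))
      (measure_iUnion_abs_int_le volume _ (by positivity)
        fun l ↦ hslab k hk _ _ (by positivity))).trans ?_
    rw [← ENNReal.ofReal_add (by positivity) (by positivity)]
    exact ENNReal.ofReal_le_ofReal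
      (resonance_count_bound d hD hN hγ0.le hA (hone k hk) hCb.le)
  have hscale (k : Fin d → ℤ) (l : ℤ) (I : Fin d → ℝ) :
      |A * (∑ i, (k i : ℝ) * ω I i) + l| = A * |(∑ i, (k i : ℝ) * ω I i) + l / A| := by
    rw [← abs_of_pos hA0, ← abs_mul, abs_of_pos hA0, mul_add, mul_div_cancel₀ _ hA0.ne']
  have hpair (k : Fin d → ℤ) (I : Fin d → ℝ) (hI : I ∈ box) :
      |∑ i, (k i : ℝ) * ω I i| ≤ (∑ i, |(k i : ℝ)|) * Cb := by
    rw [Finset.sum_mul]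
    refine (Finset.abs_sum_le_sum_abs _ _).trans (Finset.sum_le_sum fun i _ ↦ ?_)
    rw [abs_mul]
    gcongr
    exact (norm_le_pi_norm (ω I) i).trans (hωbd I hI)
  refine (measure_mono (t := ⋃ k : Fin d → ℤ, ⋃ _ : k ≠ 0, bad k) ?_).trans ?_
  · rintro I ⟨hI, hnot⟩
    by_contra hgood
    simp only [mem_iUnion, not_exists] at hgood
    refine hnot ⟨hI, fun k hk l hkl ↦ ?_, fun k l hkl hlarge ↦ ?_⟩
    · by_contra! hlt
      refine hgood k hk (Or.inl ?_)
      have hl : |(l : ℝ)| ≤ N := by linarith [hone k hk]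
      simp only [mem_iUnion]
      refine ⟨l, hl, hI, ?_⟩
      rw [hscale, mul_div_assoc] at hlt
      exact lt_of_mul_lt_mul_left hlt hA0.le
    · by_contra! hlt
      have hle1 : γ / (1 + ∑ i, |(k i : ℝ)|) ^ (d + 1) ≤ 1 :=
        div_le_one_of_le₀ (hγ1.trans (one_le_pow₀ (by
          linarith [Finset.sum_nonneg fun i (_ : i ∈ Finset.univ) ↦ abs_nonneg (k i : ℝ)])))
          (by positivity)
      by_cases hk : k = 0
      · subst hk
        have hl : (1 : ℝ) ≤ |(l : ℝ)| := by
          exact_mod_cast Int.one_le_abs fun h ↦ hkl ⟨rfl, h⟩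
        simp only [Pi.zero_apply, Int.cast_zero, zero_mul, Finset.sum_const_zero, mul_zero,
          zero_add] at hlt
        simp only [Pi.zero_apply, Int.cast_zero, abs_zero, Finset.sum_const_zero] at hle1
        simp only [abs_zero, Finset.sum_const_zero] at hlt
        linarith
      · refine hgood k hk (Or.inr ?_)
        have hl : |(l : ℝ)| ≤ A * (∑ i, |(k i : ℝ)|) * Cb + 1 := by
          have h1 : |(l : ℝ)| ≤ |A * (∑ i, (k i : ℝ) * ω I i) + l|
              + |A * (∑ i, (k i : ℝ) * ω I i)| := by
            simpa using abs_sub (A * (∑ i, (k i : ℝ) * ω I i) + l) (A * (∑ i, (k i : ℝ) * ω I i))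
          have h2 : |A * (∑ i, (k i : ℝ) * ω I i)| ≤ A * ((∑ i, |(k i : ℝ)|) * Cb) := by
            rw [abs_mul, abs_of_pos hA0]
            gcongr
            exact hpair k I hI
          linarith
        simp only [mem_iUnion]
        refine ⟨l, hl, hI, ?_⟩
        have hm := hone k hk
        have hlt' : A * |(∑ i, (k i : ℝ) * ω I i) + l / A|
            < γ / (∑ i, |(k i : ℝ)|) ^ (d + 1) := by
          rw [← hscale]
          refine hlt.trans_le ?_
          gcongr
          linarith
        rwa [mul_comm A ((∑ i, |(k i : ℝ)|) ^ (d + 1)), ← div_div, lt_div_iff₀' hA0]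
  · calc _ ≤ ∑' k : Fin d → ℤ, volume (⋃ _ : k ≠ 0, bad k) := measure_iUnion_le _
      _ ≤ ∑' k : Fin d → ℤ, ENNReal.ofReal
          (D * (2 * Cb + 6) * (N * γ) * (1 / (∑ i, |(k i : ℝ)|) ^ (d + 1))) :=
        ENNReal.tsum_le_tsum hbad
      _ = ENNReal.ofReal (D * (2 * Cb + 6) * (N * γ) * W) := by
        rw [← ENNReal.ofReal_tsum_of_nonneg (fun k ↦ by positivity) (hsummable.mul_left _),
          tsum_mul_left]
      _ ≤ _ := by
        refine ENNReal.ofReal_le_ofReal ?_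
        rw [hNγ]
        have : 0 ≤ L ^ (-C₁) := by positivity
        nlinarith
end

section
/- Let n ≥ 1, let (u₀, v₀) be the solution of ẋ = y, ẏ = −x^{2n+1} with (u₀(0),v₀(0)) = (1,0), and let T₀ be its minimal period. Set α = 1/(n+2), β = 1 − α, c = 1/(αT₀). Then the action-angle map Φ(θ,I) = (x,y) with x = c^α I^α u₀(θT₀), y = c^β I^β v₀(θT₀), defined for (θ,I) ∈ R × (0,∞), satisfies det(∂(x,y)/∂(θ,I)) = 1 at every point; equivalently dx ∧ dy = dθ ∧ dI, so Φ is a symplectic transformation from T × (0,∞) (θ of period 1) to R² ∖ {0}. -/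
/-- The action-angle map for the oscillator `ẍ + x^(2n+1) = 0`:
with `(u₀,v₀)` the solution with initial data `(1,0)`, `T₀` its minimal period,
`α = 1/(n+2)`, `β = 1-α`, `c = 1/(αT₀)`, the map
`Φ(θ,I) = (c^α I^α u₀(θT₀), c^β I^β v₀(θT₀))` has Jacobian determinant `1` at every point
`(θ,I) ∈ ℝ × (0,∞)`; i.e. `dx ∧ dy = dθ ∧ dI`, so `Φ` is symplectic. -/
theorem stmt15 (n : ℕ) (hn : 1 ≤ n) (u₀ v₀ : ℝ → ℝ) (T₀ : ℝ)
    (hu₀0 : u₀ 0 = 1) (hv₀0 : v₀ 0 = 0)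
    (hode₁ : ∀ t : ℝ, HasDerivAt u₀ (v₀ t) t)
    (hode₂ : ∀ t : ℝ, HasDerivAt v₀ (-(u₀ t ^ (2 * n + 1))) t)
    (hT₀ : 0 < T₀) (hper₁ : Function.Periodic u₀ T₀) (hper₂ : Function.Periodic v₀ T₀)
    (hmin : ∀ T : ℝ, 0 < T → Function.Periodic u₀ T → Function.Periodic v₀ T → T₀ ≤ T)
    (henergy : ∀ t : ℝ, ((n : ℝ) + 1) * v₀ t ^ 2 + u₀ t ^ (2 * n + 2) = 1)
    (α β c : ℝ) (hα : α = 1 / ((n : ℝ) + 2)) (hβ : β = 1 - α) (hc : c = 1 / (α * T₀))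
    (X Y : ℝ → ℝ → ℝ)
    (hX : X = fun θ I => c ^ α * I ^ α * u₀ (θ * T₀))
    (hY : Y = fun θ I => c ^ β * I ^ β * v₀ (θ * T₀)) :
    ∀ θ I : ℝ, 0 < I →
      deriv (fun θ' => X θ' I) θ * deriv (fun I' => Y θ I') I
        - deriv (fun I' => X θ I') I * deriv (fun θ' => Y θ' I) θ = 1 := by
  intro θ I hI
  have hn2 : (0 : ℝ) < (n : ℝ) + 2 := by positivity
  have hα0 : 0 < α := by rw [hα]; positivity
  have hc0 : 0 < c := by rw [hc]; positivity
  have hcαT : c * T₀ * α = 1 := by rw [hc]; field_simp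
  have hβα : β = α * ((n : ℝ) + 1) := by rw [hβ, hα]; field_simp; ring
  have hsum : α + β = 1 := by rw [hβ]; ring
  have hscale : HasDerivAt (fun s : ℝ => s * T₀) T₀ θ := hasDerivAt_mul_const T₀
  have hXθ : HasDerivAt (fun θ' => X θ' I) (c ^ α * I ^ α * (v₀ (θ * T₀) * T₀)) θ := by
    rw [hX]
    exact ((hode₁ (θ * T₀)).comp θ hscale).const_mul (c ^ α * I ^ α)
  have hYθ : HasDerivAt (fun θ' => Y θ' I)
      (c ^ β * I ^ β * (-(u₀ (θ * T₀) ^ (2 * n + 1)) * T₀)) θ := by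
    rw [hY]
    exact ((hode₂ (θ * T₀)).comp θ hscale).const_mul (c ^ β * I ^ β)
  have hXI : HasDerivAt (fun I' => X θ I') (c ^ α * (α * I ^ (α - 1)) * u₀ (θ * T₀)) I := by
    rw [hX]
    exact ((Real.hasDerivAt_rpow_const (Or.inl hI.ne')).const_mul (c ^ α)).mul_const _
  have hYI : HasDerivAt (fun I' => Y θ I') (c ^ β * (β * I ^ (β - 1)) * v₀ (θ * T₀)) I := by
    rw [hY]
    exact ((Real.hasDerivAt_rpow_const (Or.inl hI.ne')).const_mul (c ^ β)).mul_const _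
  have hcpow : c ^ α * c ^ β = c := by rw [← Real.rpow_add hc0, hsum, Real.rpow_one]
  have hIpow : I ^ α * I ^ (β - 1) = 1 := by
    rw [← Real.rpow_add hI, show α + (β - 1) = 0 by linarith, Real.rpow_zero]
  have hIpow' : I ^ (α - 1) * I ^ β = 1 := by
    rw [← Real.rpow_add hI, show α - 1 + β = 0 by linarith, Real.rpow_zero]
  rw [hXθ.deriv, hYI.deriv, hXI.deriv, hYθ.deriv]
  calc
    _ = (c ^ α * c ^ β) * T₀ * ((I ^ α * I ^ (β - 1)) * β * v₀ (θ * T₀) ^ 2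
          + (I ^ (α - 1) * I ^ β) * α * u₀ (θ * T₀) ^ (2 * n + 2)) := by ring
    _ = c * T₀ * α * (((n : ℝ) + 1) * v₀ (θ * T₀) ^ 2 + u₀ (θ * T₀) ^ (2 * n + 2)) := by
      rw [hcpow, hIpow, hIpow', hβα]; ring
    _ = 1 := by rw [hcαT, henergy, mul_one]
end
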